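/- arXiv:2302.13710 — 5 statements merged into one kernel-verified Lean document; each statement's English description precedes it below -/
import Mathlib

section
/- (Lemma 1, bilevel reformulation) The optimal mean-variance value equals the bilevel optimum over pseudo means: min_{d ∈ D} η^d = inf_{y ∈ ℝ} min_{d ∈ D} η̃^d(y) = inf_{y ∈ ℝ} η̃*(y), and the infimum over y ∈ ℝ is attained. -/
open Finset

/-- The steady-state mean `μ = ∑ i, π i * r i` of a reward vector `r` under a
probability vector `π`. -/
def mdpMean {S : Type*} [Fintype S] (π r : S → ℝ) : ℝ := ∑ i, π i * r i

/-- The steady-state variance `σ = ∑ i, π i * (r i - μ)²`. -/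
def mdpVar {S : Type*} [Fintype S] (π r : S → ℝ) : ℝ :=
  ∑ i, π i * (r i - mdpMean π r)^2

/-- The pseudo variance `σ̃(y) = ∑ i, π i * (r i - y)²` with pseudo mean `y`. -/
def mdpPseudoVar {S : Type*} [Fintype S] (π r : S → ℝ) (y : ℝ) : ℝ :=
  ∑ i, π i * (r i - y)^2

/-- The mean-variance objective `η = β·σ - μ`. -/
def mdpEta {S : Type*} [Fintype S] (π r : S → ℝ) (β : ℝ) : ℝ :=
  β * mdpVar π r - mdpMean π r

/-- The pseudo mean-variance objective `η̃(y) = β·σ̃(y) - μ`. -/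
def mdpPseudoEta {S : Type*} [Fintype S] (π r : S → ℝ) (β y : ℝ) : ℝ :=
  β * mdpPseudoVar π r y - mdpMean π r

/-- The optimal pseudo mean-variance objective `η̃*(y) = min_{d ∈ D} η̃^d(y)`. -/
def mdpPseudoEtaStar {S D : Type*} [Fintype S] [Fintype D] [Nonempty D]
    (π r : D → S → ℝ) (β y : ℝ) : ℝ :=
  Finset.univ.inf' Finset.univ_nonempty (fun d => mdpPseudoEta (π d) (r d) β y)

/-- The pseudo variance exceeds the variance by the squared deviation of `y` from the mean. -/
theorem mdpPseudoVar_eq {S : Type*} [Fintype S] {π : S → ℝ} (hπ : ∑ i, π i = 1) (r : S → ℝ)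
    (y : ℝ) : mdpPseudoVar π r y = mdpVar π r + (mdpMean π r - y) ^ 2 := by
  have expand (c : ℝ) : mdpPseudoVar π r c =
      ∑ i, π i * r i ^ 2 - 2 * c * mdpMean π r + c ^ 2 := by
    calc mdpPseudoVar π r c
        = ∑ i, (π i * r i ^ 2 - 2 * c * (π i * r i) + c ^ 2 * π i) :=
          Finset.sum_congr rfl fun i _ => by ring
      _ = _ := by
          rw [Finset.sum_add_distrib, Finset.sum_sub_distrib, ← Finset.mul_sum, ← Finset.mul_sum,
            hπ, mul_one, mdpMean]
  have hvar : mdpVar π r = mdpPseudoVar π r (mdpMean π r) := rfl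
  rw [hvar, expand, expand]
  ring

/-- The pseudo objective exceeds the objective by `β` times the squared deviation of `y` from the
mean. -/
theorem mdpPseudoEta_eq {S : Type*} [Fintype S] {π : S → ℝ} (hπ : ∑ i, π i = 1) (r : S → ℝ)
    (β y : ℝ) : mdpPseudoEta π r β y = mdpEta π r β + β * (mdpMean π r - y) ^ 2 := by
  rw [mdpPseudoEta, mdpEta, mdpPseudoVar_eq hπ]
  ring

/-- Lemma 1 (bilevel reformulation): the optimal mean-variance value
`min_{d ∈ D} η^d` is the least element of the range of `y ↦ η̃*(y)`, i.e.
`min_d η^d = inf_{y ∈ ℝ} min_{d ∈ D} η̃^d(y)` and the infimum over `y` is attained. -/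
theorem bilevel_reformulation {S D : Type*} [Fintype S] [Nonempty S]
    [Fintype D] [Nonempty D]
    (π r : D → S → ℝ)
    (hπ : ∀ d i, 0 ≤ π d i) (hπsum : ∀ d, ∑ i, π d i = 1)
    (β : ℝ) (hβ : 0 ≤ β) :
    IsLeast (Set.range (fun y : ℝ => mdpPseudoEtaStar π r β y))
      (Finset.univ.inf' Finset.univ_nonempty (fun d : D => mdpEta (π d) (r d) β)) := by
  have le_star (y : ℝ) : Finset.univ.inf' Finset.univ_nonempty
      (fun d : D => mdpEta (π d) (r d) β) ≤ mdpPseudoEtaStar π r β y := by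
    refine Finset.inf'_mono_fun fun d _ => ?_
    rw [mdpPseudoEta_eq (hπsum d)]
    exact le_add_of_nonneg_right (by positivity)
  refine ⟨?_, ?_⟩
  · obtain ⟨d, hd, hmin⟩ := Finset.exists_mem_eq_inf' Finset.univ_nonempty
      (fun d : D => mdpEta (π d) (r d) β)
    refine ⟨mdpMean (π d) (r d), le_antisymm ?_ (le_star _)⟩
    rw [hmin]
    exact Finset.inf'_le _ hd
  · rintro _ ⟨y, rfl⟩
    exact le_star y
end

section
/- (Restriction of the outer variable to the reward range, eq. (9)) There exists a policy d* ∈ D attaining min_{d ∈ D} η^d such that, setting y* = μ^{d*}, one has η̃*(y*) = min_{d ∈ D} η^d and y* lies in the interval [r̲, r̄], where r̲ = min_{d ∈ D, i ∈ S} r^d(i) and r̄ = max_{d ∈ D, i ∈ S} r^d(i). Consequently min_{d ∈ D} η^d = min_{y ∈ [r̲, r̄]} η̃*(y). -/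
open Finset

/-- Steiner's identity: the pseudo variance exceeds the variance by `(μ - y)²`. -/
theorem mdpPseudoVar_eq_add_sq {S : Type*} [Fintype S] {π : S → ℝ} (r : S → ℝ)
    (hsum : ∑ i, π i = 1) (y : ℝ) :
    mdpPseudoVar π r y = mdpVar π r + (mdpMean π r - y) ^ 2 := by
  have expand (z : ℝ) :
      ∑ i, π i * (r i - z) ^ 2 = ∑ i, π i * r i ^ 2 - 2 * z * mdpMean π r + z ^ 2 := by
    calc ∑ i, π i * (r i - z) ^ 2
        = ∑ i, (π i * r i ^ 2 - 2 * z * (π i * r i) + z ^ 2 * π i) :=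
          Finset.sum_congr rfl fun i _ => by ring
      _ = _ := by
          rw [Finset.sum_add_distrib, Finset.sum_sub_distrib, ← Finset.mul_sum,
            ← Finset.mul_sum, hsum, mul_one, mdpMean]
  rw [mdpPseudoVar, mdpVar, expand, expand]
  ring

theorem mdpPseudoEta_mdpMean {S : Type*} [Fintype S] (π r : S → ℝ) (β : ℝ) :
    mdpPseudoEta π r β (mdpMean π r) = mdpEta π r β := rfl

theorem mdpEta_le_mdpPseudoEta {S : Type*} [Fintype S] {π : S → ℝ} (r : S → ℝ)
    (hsum : ∑ i, π i = 1) {β : ℝ} (hβ : 0 ≤ β) (y : ℝ) :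
    mdpEta π r β ≤ mdpPseudoEta π r β y := by
  rw [mdpEta, mdpPseudoEta, mdpPseudoVar_eq_add_sq r hsum]
  gcongr
  exact le_add_of_nonneg_right (sq_nonneg _)

theorem mdpMean_mem_Icc {S : Type*} [Fintype S] {π r : S → ℝ} (hπ : ∀ i, 0 ≤ π i)
    (hsum : ∑ i, π i = 1) {a b : ℝ} (h : ∀ i, r i ∈ Set.Icc a b) :
    mdpMean π r ∈ Set.Icc a b :=
  (convex_Icc a b).sum_mem (fun i _ => hπ i) hsum (fun i _ => h i)

theorem inf'_mdpEta_le_mdpPseudoEtaStar {S D : Type*} [Fintype S] [Fintype D] [Nonempty D]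
    {π : D → S → ℝ} (r : D → S → ℝ) (hsum : ∀ d, ∑ i, π d i = 1) {β : ℝ} (hβ : 0 ≤ β)
    (y : ℝ) :
    Finset.univ.inf' Finset.univ_nonempty (fun d : D => mdpEta (π d) (r d) β)
      ≤ mdpPseudoEtaStar π r β y :=
  Finset.inf'_mono_fun fun d _ => mdpEta_le_mdpPseudoEta (r d) (hsum d) hβ y

/-- Restriction of the outer variable to the reward range (eq. (9)): there is an optimal
policy `d*` for the mean-variance problem such that the pseudo mean `y* = μ^{d*}` attains
the optimal value of the bilevel problem and lies in `[r̲, r̄]`, where `r̲` and `r̄` are the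
smallest and largest rewards; consequently `min_d η^d = min_{y ∈ [r̲, r̄]} η̃*(y)`. -/
theorem outer_variable_in_reward_range {S D : Type*} [Fintype S] [Nonempty S]
    [Fintype D] [Nonempty D]
    (π r : D → S → ℝ)
    (hπ : ∀ d i, 0 ≤ π d i) (hπsum : ∀ d, ∑ i, π d i = 1)
    (β : ℝ) (hβ : 0 ≤ β) :
    ∃ dstar : D,
      (∀ d : D, mdpEta (π dstar) (r dstar) β ≤ mdpEta (π d) (r d) β) ∧
      mdpPseudoEtaStar π r β (mdpMean (π dstar) (r dstar))
        = Finset.univ.inf' Finset.univ_nonempty (fun d : D => mdpEta (π d) (r d) β) ∧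
      mdpMean (π dstar) (r dstar) ∈
        Set.Icc
          (Finset.univ.inf' Finset.univ_nonempty (fun z : D × S => r z.1 z.2))
          (Finset.univ.sup' Finset.univ_nonempty (fun z : D × S => r z.1 z.2)) ∧
      IsLeast
        ((fun y : ℝ => mdpPseudoEtaStar π r β y) ''
          Set.Icc
            (Finset.univ.inf' Finset.univ_nonempty (fun z : D × S => r z.1 z.2))
            (Finset.univ.sup' Finset.univ_nonempty (fun z : D × S => r z.1 z.2)))
        (Finset.univ.inf' Finset.univ_nonempty (fun d : D => mdpEta (π d) (r d) β)) := by
  obtain ⟨dstar, -, hd⟩ := Finset.exists_mem_eq_inf' Finset.univ_nonempty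
    (fun d : D => mdpEta (π d) (r d) β)
  have hstar : mdpPseudoEtaStar π r β (mdpMean (π dstar) (r dstar))
      = Finset.univ.inf' Finset.univ_nonempty (fun d : D => mdpEta (π d) (r d) β) := by
    refine le_antisymm ?_ (inf'_mdpEta_le_mdpPseudoEtaStar r hπsum hβ _)
    rw [hd, ← mdpPseudoEta_mdpMean]
    exact Finset.inf'_le _ (Finset.mem_univ dstar)
  have hmem : mdpMean (π dstar) (r dstar) ∈ Set.Icc
      (Finset.univ.inf' Finset.univ_nonempty (fun z : D × S => r z.1 z.2))
      (Finset.univ.sup' Finset.univ_nonempty (fun z : D × S => r z.1 z.2)) :=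
    mdpMean_mem_Icc (hπ dstar) (hπsum dstar) fun i =>
    ⟨Finset.inf'_le (fun z : D × S => r z.1 z.2) (Finset.mem_univ (dstar, i)),
      Finset.le_sup' (fun z : D × S => r z.1 z.2) (Finset.mem_univ (dstar, i))⟩
  refine ⟨dstar, fun d => hd ▸ Finset.inf'_le _ (Finset.mem_univ d), hstar, hmem,
    ⟨_, hmem, hstar⟩, ?_⟩
  rintro _ ⟨y, -, rfl⟩
  exact inf'_mdpEta_le_mdpPseudoEtaStar r hπsum hβ y
end

section
/- (Key comparison inequality, eq. (10)) Let y ∈ ℝ and let d̃* ∈ D be optimal for the pseudo problem at y. Then for every policy d ∈ D, η^{d̃*} + β·(y − μ^{d̃*})² ≤ η^d + β·(y − μ^d)². -/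
open Finset

/-- Decomposition of the pseudo variance around the mean: `σ̃(y) = σ + (y - μ)²`. -/
theorem mdpPseudoVar_eq_mdpVar_add_sq {S : Type*} [Fintype S] (π r : S → ℝ)
    (hsum : ∑ i, π i = 1) (y : ℝ) :
    mdpPseudoVar π r y = mdpVar π r + (y - mdpMean π r) ^ 2 := by
  have expand (c : ℝ) :
      ∑ i, π i * (r i - c) ^ 2 = ∑ i, π i * r i ^ 2 - 2 * c * mdpMean π r + c ^ 2 := by
    calc ∑ i, π i * (r i - c) ^ 2
        = ∑ i, (π i * r i ^ 2 - 2 * c * (π i * r i) + π i * c ^ 2) :=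
          Finset.sum_congr rfl fun i _ => by ring
      _ = ∑ i, π i * r i ^ 2 - 2 * c * mdpMean π r + c ^ 2 := by
          rw [Finset.sum_add_distrib, Finset.sum_sub_distrib, ← Finset.mul_sum,
            ← Finset.sum_mul, hsum, one_mul, mdpMean]
  rw [mdpPseudoVar, mdpVar, expand, expand]
  ring

/-- The pseudo objective exceeds the mean-variance objective by `β * (y - μ)²`. -/
theorem mdpPseudoEta_eq_mdpEta_add {S : Type*} [Fintype S] (π r : S → ℝ)
    (hsum : ∑ i, π i = 1) (β y : ℝ) :
    mdpPseudoEta π r β y = mdpEta π r β + β * (y - mdpMean π r) ^ 2 := by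
  rw [mdpPseudoEta, mdpEta, mdpPseudoVar_eq_mdpVar_add_sq π r hsum]
  ring

/-- Key comparison inequality (eq. (10)): if `d̃*` is optimal for the pseudo problem at `y`,
then for every policy `d`, `η^{d̃*} + β·(y - μ^{d̃*})² ≤ η^d + β·(y - μ^d)²`. -/
theorem key_comparison_inequality {S D : Type*} [Fintype S] [Nonempty S]
    [Fintype D] [Nonempty D]
    (π r : D → S → ℝ)
    (hπ : ∀ d i, 0 ≤ π d i) (hπsum : ∀ d, ∑ i, π d i = 1)
    (β : ℝ) (hβ : 0 ≤ β)
    (y : ℝ) (dtil : D)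
    (hopt : mdpPseudoEta (π dtil) (r dtil) β y = mdpPseudoEtaStar π r β y) :
    ∀ d : D,
      mdpEta (π dtil) (r dtil) β + β * (y - mdpMean (π dtil) (r dtil))^2
        ≤ mdpEta (π d) (r d) β + β * (y - mdpMean (π d) (r d))^2 := by
  intro d
  rw [← mdpPseudoEta_eq_mdpEta_add _ _ (hπsum dtil), ← mdpPseudoEta_eq_mdpEta_add _ _ (hπsum d),
    hopt]
  exact Finset.inf'_le _ (Finset.mem_univ d)
end

section
/- (Local minima of the optimal pseudo objective are fixed points, eq. (16)) Suppose β > 0. If ŷ ∈ ℝ is a local minimum of the function y ↦ η̃*(y) (i.e. there exists ε > 0 such that η̃*(ŷ) ≤ η̃*(y) for all y with |y − ŷ| < ε), then there exists a policy d ∈ D optimal for the pseudo problem at ŷ with μ^d = ŷ, i.e. ŷ satisfies the fixed point equation y = μ^{d̃*(y)}. -/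
open Finset

/-- The pseudo objective is a quadratic in the pseudo mean, expanded around `y`. -/
theorem mdpPseudoEta_add {S : Type*} [Fintype S] (π r : S → ℝ) (hπ : ∑ i, π i = 1)
    (β y h : ℝ) :
    mdpPseudoEta π r β (y + h) =
      mdpPseudoEta π r β y + β * (h ^ 2 - 2 * h * (mdpMean π r - y)) := by
  have key : mdpPseudoVar π r (y + h) =
      mdpPseudoVar π r y + (h ^ 2 + 2 * h * y) * ∑ i, π i - 2 * h * mdpMean π r := by
    simp only [mdpPseudoVar, mdpMean, Finset.mul_sum, ← Finset.sum_add_distrib,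
      ← Finset.sum_sub_distrib]
    exact Finset.sum_congr rfl fun i _ => by ring
  rw [mdpPseudoEta, mdpPseudoEta, key, hπ]
  ring

/-- Local minima of the optimal pseudo objective are fixed points (eq. (16)): if `β > 0` and
`ŷ` is a local minimum of `y ↦ η̃*(y)`, then some policy `d` optimal for the pseudo problem
at `ŷ` satisfies `μ^d = ŷ`, i.e. `ŷ` solves the fixed point equation `y = μ^{d̃*(y)}`. -/
theorem localMin_is_fixed_point {S D : Type*} [Fintype S] [Nonempty S]
    [Fintype D] [Nonempty D]
    (π r : D → S → ℝ)
    (hπ : ∀ d i, 0 ≤ π d i) (hπsum : ∀ d, ∑ i, π d i = 1)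
    (β : ℝ) (hβ : 0 < β)
    (yhat : ℝ)
    (hloc : ∃ ε : ℝ, 0 < ε ∧ ∀ y : ℝ, |y - yhat| < ε →
      mdpPseudoEtaStar π r β yhat ≤ mdpPseudoEtaStar π r β y) :
    ∃ d : D,
      mdpPseudoEta (π d) (r d) β yhat = mdpPseudoEtaStar π r β yhat ∧
      mdpMean (π d) (r d) = yhat := by
  obtain ⟨ε, hε, hmin⟩ := hloc
  obtain ⟨d, -, hd⟩ := Finset.exists_mem_eq_inf' (Finset.univ_nonempty (α := D))
    (fun d => mdpPseudoEta (π d) (r d) β yhat)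
  change mdpPseudoEtaStar π r β yhat = mdpPseudoEta (π d) (r d) β yhat at hd
  refine ⟨d, hd.symm, ?_⟩
  by_contra hne
  set m := mdpMean (π d) (r d) - yhat with hm
  have hm0 : 0 < |m| := abs_pos.mpr (sub_ne_zero.mpr hne)
  obtain ⟨t, ht0, ht1, htε⟩ : ∃ t : ℝ, 0 < t ∧ t < 1 ∧ t * |m| < ε := by
    refine ⟨ε / (ε + |m|), by positivity, ?_, ?_⟩
    · rw [div_lt_one (by positivity)]
      linarith
    · rw [div_mul_eq_mul_div, div_lt_iff₀ (by positivity)]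
      nlinarith
  have h₁ := hmin (yhat + t * m) (by rwa [add_sub_cancel_left, abs_mul, abs_of_pos ht0])
  have h₂ : mdpPseudoEtaStar π r β (yhat + t * m) ≤
      mdpPseudoEta (π d) (r d) β (yhat + t * m) :=
    Finset.inf'_le (fun d => mdpPseudoEta (π d) (r d) β (yhat + t * m)) (Finset.mem_univ d)
  rw [mdpPseudoEta_add _ _ (hπsum d), ← hm] at h₂
  have h₃ : 0 < β * (t * (2 - t) * |m| ^ 2) := by
    have : 0 < 2 - t := by linarith
    positivity
  rw [sq_abs] at h₃
  linarith
end

section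
/- (Invertibility of the generalized fundamental matrix) Let S be a nonempty finite set and let P be an S × S real matrix that is row-stochastic (all entries nonnegative and each row sums to 1). Let e denote the all-ones column vector. Suppose (i) there exists a row vector π with π·P = π and π·e = 1, and (ii) every column vector x ∈ ℝ^S with P·x = x is a scalar multiple of e. Then the matrix I − P + E is invertible, where I is the identity matrix and E = e·eᵀ is the all-ones matrix. -/
open Matrix

/-- Invertibility of the generalized fundamental matrix: if `P` is a row-stochastic matrix
admitting a stationary distribution (a row vector `π` with `π·P = π` and `π·e = 1`) and
every column vector fixed by `P` is a scalar multiple of the all-ones vector `e`, then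
`I - P + e·eᵀ` is invertible. -/
theorem fundamentalMatrix_invertible {S : Type*} [Fintype S] [Nonempty S] [DecidableEq S]
    (P : Matrix S S ℝ)
    (hnn : ∀ i j, 0 ≤ P i j) (hrow : ∀ i, ∑ j, P i j = 1)
    (hstat : ∃ π : S → ℝ, π ᵥ* P = π ∧ ∑ i, π i * 1 = 1)
    (hfix : ∀ x : S → ℝ, P *ᵥ x = x → ∃ c : ℝ, x = fun _ => c) :
    IsUnit (1 - P + Matrix.of (fun _ _ : S => (1 : ℝ))) := by
  obtain ⟨π, hπ, hπ1⟩ := hstat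
  rw [← Matrix.mulVec_injective_iff_isUnit, ← Matrix.coe_mulVecLin,
    injective_iff_map_eq_zero]
  intro x hx
  have hE : Matrix.of (fun _ _ : S => (1 : ℝ)) *ᵥ x = fun _ => ∑ j, x j := by
    ext i
    simp [Matrix.mulVec, dotProduct]
  rw [Matrix.mulVecLin_apply, Matrix.add_mulVec, Matrix.sub_mulVec, Matrix.one_mulVec, hE] at hx
  have hsum : ∑ j, x j = 0 := by
    have h := congrArg (π ⬝ᵥ ·) hx
    simp only [dotProduct_add, dotProduct_sub, Matrix.dotProduct_mulVec, hπ, sub_self,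
      zero_add, dotProduct_zero] at h
    simp only [mul_one] at hπ1
    simpa [dotProduct, ← Finset.sum_mul, hπ1] using h
  have hP : P *ᵥ x = x := by
    ext i
    have h := congrFun hx i
    simp only [Pi.add_apply, Pi.sub_apply, Pi.zero_apply, hsum] at h
    linarith
  obtain ⟨c, rfl⟩ := hfix x hP
  have hc : c = 0 := by simpa using hsum
  ext
  exact hc
end
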